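/- Let p > 2. There exist ν₀ > 0, a smooth function Y : ℝ → ℝ with ∫_ℝ Y² = 1 satisfying −Y'' + Y − p·Q^(p−1)·Y = −ν₀²·Y on ℝ with |Y(x)| ≤ C·e^(−√(1+ν₀²)·|x|) for some C > 0, and a constant c > 0 such that for every continuously differentiable function ε : ℝ → ℝ with ε and ε' square-integrable: ∫_ℝ ((ε')² + ε² − p·Q^(p−1)·ε²) dx ≥ c·∫_ℝ ((ε')² + ε²) dx − c^(−1)·((∫_ℝ ε·Y dx)² + (∫_ℝ ε·Q' dx)²). -/

import Mathlib

open MeasureTheory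

/-- The ground state of the one-dimensional nonlinear Klein-Gordon equation. -/
noncomputable def Q (p : ℝ) (x : ℝ) : ℝ :=
  ((p + 1) / (2 * Real.cosh ((p - 1) / 2 * x) ^ 2)) ^ (1 / (p - 1))

open Set Filter Topology

/-! ### Functions of finite energy -/

/-- Continuously differentiable functions on the line with finite `H¹` norm. -/
structure FiniteEnergy (f : ℝ → ℝ) : Prop where
  contDiff : ContDiff ℝ 1 f
  sq : Integrable fun x => f x ^ 2
  deriv_sq : Integrable fun x => deriv f x ^ 2

lemma integrable_mul_of_integrable_sq {f g : ℝ → ℝ} (hf : Continuous f) (hg : Continuous g)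
    (hf2 : Integrable fun x => f x ^ 2) (hg2 : Integrable fun x => g x ^ 2) :
    Integrable fun x => f x * g x :=
  ((memLp_two_iff_integrable_sq hf.aestronglyMeasurable).2 hf2).integrable_mul
    ((memLp_two_iff_integrable_sq hg.aestronglyMeasurable).2 hg2)

lemma integrable_add_sq {f g : ℝ → ℝ} (hf : Continuous f) (hg : Continuous g)
    (hf2 : Integrable fun x => f x ^ 2) (hg2 : Integrable fun x => g x ^ 2) :
    Integrable fun x => (f x + g x) ^ 2 := by
  have h := (hf2.add ((integrable_mul_of_integrable_sq hf hg hf2 hg2).const_mul 2)).add hg2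
  refine h.congr (Eventually.of_forall fun x => ?_)
  simp only [Pi.add_apply]
  ring

namespace FiniteEnergy

variable {f g : ℝ → ℝ}

lemma continuous (hf : FiniteEnergy f) : Continuous f := hf.contDiff.continuous

lemma continuous_deriv (hf : FiniteEnergy f) : Continuous (deriv f) :=
  hf.contDiff.continuous_deriv le_rfl

lemma hasDerivAt (hf : FiniteEnergy f) (x : ℝ) : HasDerivAt f (deriv f x) x :=
  (hf.contDiff.differentiable one_ne_zero x).hasDerivAt

lemma add (hf : FiniteEnergy f) (hg : FiniteEnergy g) : FiniteEnergy fun x => f x + g x where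
  contDiff := hf.contDiff.add hg.contDiff
  sq := integrable_add_sq hf.continuous hg.continuous hf.sq hg.sq
  deriv_sq := by
    refine (integrable_add_sq hf.continuous_deriv hg.continuous_deriv hf.deriv_sq
      hg.deriv_sq).congr (Eventually.of_forall fun x => ?_)
    simp only [((hf.hasDerivAt x).fun_add (hg.hasDerivAt x)).deriv]

lemma const_mul (hf : FiniteEnergy f) (c : ℝ) : FiniteEnergy fun x => c * f x where
  contDiff := contDiff_const.mul hf.contDiff
  sq := by simpa only [mul_pow] using hf.sq.const_mul (c ^ 2)
  deriv_sq := by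
    refine (hf.deriv_sq.const_mul (c ^ 2)).congr (Eventually.of_forall fun x => ?_)
    simp only [((hf.hasDerivAt x).const_mul c).deriv, mul_pow]

lemma integrable_mul (hf : FiniteEnergy f) (hg : FiniteEnergy g) :
    Integrable fun x => f x * g x :=
  integrable_mul_of_integrable_sq hf.continuous hg.continuous hf.sq hg.sq

lemma hasDerivAt_sq (hf : FiniteEnergy f) (x : ℝ) :
    HasDerivAt (fun x => f x ^ 2) (2 * (f x * deriv f x)) x := by
  refine ((hf.hasDerivAt x).fun_pow 2).congr_deriv ?_
  push_cast
  ring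

lemma tendsto_sq_atTop (hf : FiniteEnergy f) : Tendsto (fun x => f x ^ 2) atTop (𝓝 0) :=
  tendsto_zero_of_hasDerivAt_of_integrableOn_Ioi (a := 0) (fun x _ => hf.hasDerivAt_sq x)
    ((integrable_mul_of_integrable_sq hf.continuous hf.continuous_deriv hf.sq
      hf.deriv_sq).const_mul 2).integrableOn hf.sq.integrableOn

lemma tendsto_sq_atBot (hf : FiniteEnergy f) : Tendsto (fun x => f x ^ 2) atBot (𝓝 0) :=
  tendsto_zero_of_hasDerivAt_of_integrableOn_Iic (a := 0) (fun x _ => hf.hasDerivAt_sq x)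
    ((integrable_mul_of_integrable_sq hf.continuous hf.continuous_deriv hf.sq
      hf.deriv_sq).const_mul 2).integrableOn hf.sq.integrableOn

end FiniteEnergy

/-! ### Hyperbolic functions -/

lemma hasDerivAt_tanh_mul (a x : ℝ) :
    HasDerivAt (fun x => Real.tanh (a * x)) (a * (1 - Real.tanh (a * x) ^ 2)) x := by
  have hc : Real.cosh (a * x) ≠ 0 := (Real.cosh_pos _).ne'
  have hl : HasDerivAt (fun x : ℝ => a * x) a x := by simpa using (hasDerivAt_id x).const_mul a
  have h := hl.sinh.div hl.cosh hc
  simp only [Real.tanh_eq_sinh_div_cosh]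
  refine h.congr_deriv ?_
  field_simp

lemma hasDerivAt_cosh_mul_rpow (a k x : ℝ) :
    HasDerivAt (fun x => Real.cosh (a * x) ^ (-k))
      (-(k * a) * (Real.tanh (a * x) * Real.cosh (a * x) ^ (-k))) x := by
  have hc : 0 < Real.cosh (a * x) := Real.cosh_pos _
  have hl : HasDerivAt (fun x : ℝ => a * x) a x := by simpa using (hasDerivAt_id x).const_mul a
  convert hl.cosh.rpow_const (p := -k) (Or.inl hc.ne') using 1
  rw [Real.rpow_sub_one hc.ne', Real.tanh_eq_sinh_div_cosh]
  field_simp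

lemma one_sub_tanh_sq (x : ℝ) : 1 - Real.tanh x ^ 2 = 1 / Real.cosh x ^ 2 := by
  have hc : Real.cosh x ≠ 0 := (Real.cosh_pos _).ne'
  rw [Real.tanh_eq_sinh_div_cosh]
  field_simp
  linarith [Real.cosh_sq x]

lemma tanh_sq_le_one (x : ℝ) : Real.tanh x ^ 2 ≤ 1 := by
  have := one_sub_tanh_sq x
  have : 0 ≤ 1 / Real.cosh x ^ 2 := by positivity
  linarith

lemma continuous_tanh_mul (a : ℝ) : Continuous fun x => Real.tanh (a * x) :=
  continuous_iff_continuousAt.2 fun x => (hasDerivAt_tanh_mul a x).continuousAt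

lemma continuous_cosh_mul_rpow (a k : ℝ) : Continuous fun x => Real.cosh (a * x) ^ (-k) :=
  continuous_iff_continuousAt.2 fun x => (hasDerivAt_cosh_mul_rpow a k x).continuousAt

lemma cosh_mul_rpow_le {a k : ℝ} (ha : 0 ≤ a) (hk : 0 ≤ k) (x : ℝ) :
    Real.cosh (a * x) ^ (-k) ≤ 2 ^ k * Real.exp (-(k * a) * |x|) := by
  have h : Real.exp (a * |x|) / 2 ≤ Real.cosh (a * x) := by
    rw [← Real.cosh_abs, abs_mul, abs_of_nonneg ha, Real.cosh_eq]
    have := Real.exp_pos (-(a * |x|))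
    linarith
  calc Real.cosh (a * x) ^ (-k) ≤ (Real.exp (a * |x|) / 2) ^ (-k) :=
        Real.rpow_le_rpow_of_nonpos (by positivity) h (by linarith)
    _ = 2 ^ k * Real.exp (-(k * a) * |x|) := by
        rw [Real.rpow_neg (by positivity), Real.div_rpow (Real.exp_pos _).le zero_le_two,
          ← Real.exp_mul, inv_div, div_eq_mul_inv, ← Real.exp_neg]
        congr 2
        ring

lemma integrable_sq_cosh_mul_rpow {a k : ℝ} (ha : 0 < a) (hk : 1 ≤ k * a) :
    Integrable fun x => (Real.cosh (a * x) ^ (-k)) ^ 2 := by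
  have hk0 : 0 ≤ k := by
    by_contra h
    nlinarith
  refine (integrable_inv_one_add_sq.const_mul ((2 ^ k) ^ 2)).mono'
    ((continuous_cosh_mul_rpow a k).pow 2).aestronglyMeasurable (Eventually.of_forall fun x => ?_)
  have hexp : Real.exp (-(k * a) * |x|) ^ 2 ≤ (1 + x ^ 2)⁻¹ := by
    rw [← Real.exp_nat_mul, ← neg_neg (_ * _), Real.exp_neg]
    have hx := Real.quadratic_le_exp_of_nonneg (abs_nonneg x)
    have h2 : Real.exp (2 * |x|) ≤ Real.exp (-(((2 : ℕ) : ℝ) * (-(k * a) * |x|))) := by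
      apply Real.exp_le_exp.2
      push_cast
      nlinarith [abs_nonneg x]
    have h3 := Real.quadratic_le_exp_of_nonneg (x := 2 * |x|) (by positivity)
    gcongr
    nlinarith [abs_nonneg x, sq_abs x]
  rw [Real.norm_of_nonneg (by positivity)]
  calc (Real.cosh (a * x) ^ (-k)) ^ 2 ≤ (2 ^ k * Real.exp (-(k * a) * |x|)) ^ 2 := by
        gcongr
        exact cosh_mul_rpow_le ha.le hk0 x
    _ ≤ (2 ^ k) ^ 2 * (1 + x ^ 2)⁻¹ := by
        rw [mul_pow]
        gcongr

lemma integrable_sq_of_abs_le_cosh_mul_rpow {a k C : ℝ} (ha : 0 < a) (hk : 1 ≤ k * a)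
    {f : ℝ → ℝ} (hf : Continuous f) (h : ∀ x, |f x| ≤ C * Real.cosh (a * x) ^ (-k)) :
    Integrable fun x => f x ^ 2 := by
  refine ((integrable_sq_cosh_mul_rpow ha hk).const_mul (C ^ 2)).mono'
    (hf.pow 2).aestronglyMeasurable (Eventually.of_forall fun x => ?_)
  rw [Real.norm_of_nonneg (by positivity), ← sq_abs, ← mul_pow]
  exact pow_le_pow_left₀ (abs_nonneg _) (h x) 2

/-! ### The energy form -/

/-- The Pöschl–Teller potential `p Q ^ (p - 1)`, where `a = (p - 1) / 2`. -/
noncomputable def potential (a x : ℝ) : ℝ :=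
  (1 + a) * (1 + 2 * a) * (1 - Real.tanh (a * x) ^ 2)

/-- The quadratic form of the linearized operator. -/
noncomputable def energy (a : ℝ) (f : ℝ → ℝ) : ℝ :=
  ∫ x, (deriv f x ^ 2 + f x ^ 2 - potential a x * f x ^ 2)

lemma FiniteEnergy.integrable_sech_sq_mul {f g : ℝ → ℝ} (hf : FiniteEnergy f)
    (hg : FiniteEnergy g) (a c : ℝ) :
    Integrable fun x => c * (1 - Real.tanh (a * x) ^ 2) * (f x * g x) := by
  have ht := continuous_tanh_mul a
  refine (hf.integrable_mul hg).bdd_mul (c := |c|)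
    (continuous_const.mul (continuous_const.sub (ht.pow 2))).aestronglyMeasurable
    (Eventually.of_forall fun x => ?_)
  rw [Real.norm_eq_abs, abs_mul]
  have h1 := tanh_sq_le_one (a * x)
  refine mul_le_of_le_one_right (abs_nonneg c) ?_
  rw [abs_le]
  constructor <;> linarith [sq_nonneg (Real.tanh (a * x))]

lemma integrable_potential_mul_sq {a : ℝ} {f : ℝ → ℝ} (hf : FiniteEnergy f) :
    Integrable fun x => potential a x * f x ^ 2 := by
  simpa only [potential, sq (f _)] using hf.integrable_sech_sq_mul hf a ((1 + a) * (1 + 2 * a))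

lemma integrable_energy {a : ℝ} {f : ℝ → ℝ} (hf : FiniteEnergy f) :
    Integrable fun x => deriv f x ^ 2 + f x ^ 2 - potential a x * f x ^ 2 :=
  (hf.deriv_sq.add hf.sq).sub (integrable_potential_mul_sq hf)

lemma le_energy {a : ℝ} (ha : 0 ≤ a) {f : ℝ → ℝ} (hf : FiniteEnergy f) :
    (∫ x, (deriv f x ^ 2 + f x ^ 2)) - (1 + a) * (1 + 2 * a) * ∫ x, f x ^ 2 ≤ energy a f := by
  have hH : Integrable fun x => deriv f x ^ 2 + f x ^ 2 := hf.deriv_sq.add hf.sq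
  rw [← integral_const_mul, ← integral_sub hH (hf.sq.const_mul _)]
  refine integral_mono (hH.sub (hf.sq.const_mul _)) (integrable_energy hf) fun x => ?_
  have hM : 0 ≤ (1 + a) * (1 + 2 * a) := by positivity
  have := mul_nonneg hM (mul_nonneg (sq_nonneg (Real.tanh (a * x))) (sq_nonneg (f x)))
  simp only [potential]
  linarith

/-- Adding `w` changes the energy by the pairing of `2f + w` with the image of `w` under the
linearized operator. -/
lemma energy_add {a : ℝ} {f w h : ℝ → ℝ} (hf : FiniteEnergy f) (hw : FiniteEnergy w)
    (hh : FiniteEnergy h)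
    (hw' : ∀ x, HasDerivAt (deriv w) (w x - potential a x * w x + h x) x) :
    energy a (fun x => f x + w x) = energy a f - ∫ x, (2 * f x + w x) * h x := by
  have hu : FiniteEnergy fun x => 2 * f x + w x := (hf.const_mul 2).add hw
  have hu' (x : ℝ) : HasDerivAt (fun x => 2 * f x + w x) (2 * deriv f x + deriv w x) x :=
    ((hf.hasDerivAt x).const_mul 2).fun_add (hw.hasDerivAt x)
  have hdu : deriv (fun x => 2 * f x + w x) = fun x => 2 * deriv f x + deriv w x :=
    funext fun x => (hu' x).deriv
  have i1 : Integrable fun x => (2 * deriv f x + deriv w x) * deriv w x := by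
    have := integrable_mul_of_integrable_sq hu.continuous_deriv hw.continuous_deriv hu.deriv_sq
      hw.deriv_sq
    rwa [hdu] at this
  have i2 : Integrable fun x => (2 * f x + w x) * (w x - potential a x * w x + h x) := by
    refine (((hu.integrable_mul hw).sub (hu.integrable_sech_sq_mul hw a
      ((1 + a) * (1 + 2 * a)))).add (hu.integrable_mul hh)).congr (Eventually.of_forall fun x => ?_)
    simp only [Pi.add_apply, Pi.sub_apply, potential]
    ring
  have hzero := integral_eq_zero_of_hasDerivAt_of_integrable
    (fun x => (hu' x).fun_mul (hw' x)) (i1.add i2)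
    (integrable_mul_of_integrable_sq hu.continuous hw.continuous_deriv hu.sq hw.deriv_sq)
  have hsum : energy a (fun x => f x + w x) =
      energy a f - (∫ x, (2 * f x + w x) * h x) + ∫ x, ((2 * deriv f x + deriv w x) * deriv w x +
        (2 * f x + w x) * (w x - potential a x * w x + h x)) := by
    have i3 : Integrable fun x => deriv f x ^ 2 + f x ^ 2 - potential a x * f x ^ 2 -
      (2 * f x + w x) * h x := (integrable_energy hf).sub (hu.integrable_mul hh)
    have i4 : Integrable fun x => (2 * deriv f x + deriv w x) * deriv w x +
      (2 * f x + w x) * (w x - potential a x * w x + h x) := i1.add i2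
    rw [energy, energy, ← integral_sub (integrable_energy hf) (hu.integrable_mul hh),
      ← integral_add i3 i4]
    congr 1
    ext x
    rw [((hf.hasDerivAt x).fun_add (hw.hasDerivAt x)).deriv]
    ring
  rw [hsum, hzero, add_zero]

/-! ### Positivity under Dirichlet conditions at two symmetric points -/

lemma continuousAt_sq_div {f g : ℝ → ℝ} {f' g' x₀ : ℝ} (hf : HasDerivAt f f' x₀)
    (hg : HasDerivAt g g' x₀) (hf0 : f x₀ = 0) (hg0 : g x₀ = 0) (hg' : g' ≠ 0) :
    ContinuousAt (fun x => f x ^ 2 / g x) x₀ := by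
  rw [continuousAt_iff_punctured_nhds]
  have h := ((hasDerivAt_iff_tendsto_slope.1 hf).mul
    (hf.continuousAt.tendsto.mono_left nhdsWithin_le_nhds)).div
    (hasDerivAt_iff_tendsto_slope.1 hg) hg'
  simp only [hf0, hg0, mul_zero, zero_div, div_zero] at h ⊢
  refine h.congr' ?_
  filter_upwards [self_mem_nhdsWithin] with x hx
  have hx' : x - x₀ ≠ 0 := sub_ne_zero.2 hx
  simp only [Pi.div_apply, slope_def_field, hf0, hg0, sub_zero]
  rcases eq_or_ne (g x) 0 with h0 | h0
  · simp [h0]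
  · field_simp

/-- The logarithmic derivative, as a function of `tanh`, of a solution with exactly two zeros. -/
noncomputable def riccati (a T : ℝ) : ℝ :=
  T * (-(1 / 2) + 2 * a * (1 + 3 * a) * (1 - T ^ 2) / ((1 + 3 * a) * T ^ 2 - a))

lemma hasDerivAt_riccati {a x : ℝ} (h : (1 + 3 * a) * Real.tanh (a * x) ^ 2 - a ≠ 0) :
    HasDerivAt (fun x => riccati a (Real.tanh (a * x)))
      (1 / 4 - (6 * a ^ 2 + 5 / 2 * a + 1 / 4) * (1 - Real.tanh (a * x) ^ 2)
        - riccati a (Real.tanh (a * x)) ^ 2) x := by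
  have hT := hasDerivAt_tanh_mul a x
  have hT2 := hT.fun_pow 2
  have hD := (hT2.const_mul (1 + 3 * a)).sub_const a
  have hN := (hT2.const_sub 1).const_mul (2 * a * (1 + 3 * a))
  have := hT.fun_mul ((hN.fun_div hD h).const_add (-(1 / 2)))
  refine this.congr_deriv ?_
  simp only [riccati]
  generalize Real.tanh (a * x) = T at h ⊢
  obtain ⟨D, hDT⟩ : ∃ D, D = (1 + 3 * a) * T ^ 2 - a := ⟨_, rfl⟩
  rw [← hDT] at h ⊢
  field_simp
  rw [hDT]
  ring

lemma tendsto_tanh_mul_sq_atTop {a : ℝ} (ha : 0 < a) :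
    Tendsto (fun x => Real.tanh (a * x) ^ 2) atTop (𝓝 1) := by
  have hc : Tendsto (fun x => Real.cosh (a * x)) atTop atTop := by
    refine tendsto_atTop_mono (fun x => ?_) (tendsto_id.const_mul_atTop ha)
    rcases le_total 0 (a * x) with h | h
    · exact (Real.self_le_sinh_iff.2 h).trans (Real.sinh_lt_cosh _).le
    · exact h.trans (Real.cosh_pos _).le
  have h2 : Tendsto (fun x => 1 / Real.cosh (a * x) ^ 2) atTop (𝓝 0) := by
    simp only [one_div]
    exact tendsto_inv_atTop_zero.comp ((tendsto_pow_atTop two_ne_zero).comp hc)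
  have h3 := h2.const_sub 1
  simp only [sub_zero] at h3
  refine h3.congr fun x => ?_
  linarith [one_sub_tanh_sq (a * x)]

lemma abs_riccati_le {a T : ℝ} (ha : 0 < a) (hT : T ^ 2 ≤ 1)
    (h : 1 ≤ 2 * ((1 + 3 * a) * T ^ 2 - a)) :
    |riccati a T| ≤ 1 / 2 + 4 * a * (1 + 3 * a) := by
  have hD : 0 < (1 + 3 * a) * T ^ 2 - a := by linarith
  have hT1 : |T| ≤ 1 := (sq_le_one_iff_abs_le_one T).1 hT
  have hq : 2 * a * (1 + 3 * a) * (1 - T ^ 2) / ((1 + 3 * a) * T ^ 2 - a)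
      ≤ 4 * a * (1 + 3 * a) := by
    rw [div_le_iff₀ hD]
    have h1 : 0 ≤ a * (1 + 3 * a) := by positivity
    nlinarith [mul_le_mul_of_nonneg_left h h1, mul_nonneg h1 (sq_nonneg T)]
  have hq0 : 0 ≤ 2 * a * (1 + 3 * a) * (1 - T ^ 2) / ((1 + 3 * a) * T ^ 2 - a) :=
    div_nonneg (mul_nonneg (by positivity) (by linarith)) hD.le
  rw [riccati, abs_mul]
  calc _ ≤ 1 * (1 / 2 + 4 * a * (1 + 3 * a)) := by
        gcongr
        rw [abs_le]
        constructor <;> linarith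
    _ = _ := one_mul _

lemma continuousAt_riccati_mul_sq {a x : ℝ} (ha : 0 < a) {ζ : ℝ → ℝ} {ζ' : ℝ}
    (hζ : HasDerivAt ζ ζ' x) (h : (1 + 3 * a) * Real.tanh (a * x) ^ 2 - a = 0 → ζ x = 0) :
    ContinuousAt (fun x => riccati a (Real.tanh (a * x)) * ζ x ^ 2) x := by
  by_cases hE : (1 + 3 * a) * Real.tanh (a * x) ^ 2 - a = 0
  · have hT := hasDerivAt_tanh_mul a x
    have hD := ((hT.fun_pow 2).const_mul (1 + 3 * a)).sub_const a
    have hT1 : (1 + 3 * a) * (1 - Real.tanh (a * x) ^ 2) = 1 + 2 * a := by linarith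
    have hT0 : Real.tanh (a * x) ≠ 0 := by
      intro h0
      rw [h0] at hE
      norm_num at hE
      exact ha.ne' hE
    have hD' : (1 + 3 * a) * (((2 : ℕ) : ℝ) * Real.tanh (a * x) ^ (2 - 1) *
        (a * (1 - Real.tanh (a * x) ^ 2))) ≠ 0 := by
      have : (1 + 3 * a) * (((2 : ℕ) : ℝ) * Real.tanh (a * x) ^ (2 - 1) *
        (a * (1 - Real.tanh (a * x) ^ 2))) = 2 * a * (1 + 2 * a) * Real.tanh (a * x) := by
        rw [← hT1]
        push_cast
        ring
      rw [this]
      positivity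
    have hq := continuousAt_sq_div hζ hD (h hE) hE hD'
    have hTc := hT.continuousAt
    have hζc := hζ.continuousAt
    have hF : ContinuousAt (fun x => Real.tanh (a * x) * (-(1 / 2) * ζ x ^ 2 +
        2 * a * (1 + 3 * a) * (1 - Real.tanh (a * x) ^ 2) *
          (ζ x ^ 2 / ((1 + 3 * a) * Real.tanh (a * x) ^ 2 - a)))) x := by
      fun_prop
    refine hF.congr (Eventually.of_forall fun y => ?_)
    simp only [riccati]
    ring
  · exact ((hasDerivAt_riccati hE).continuousAt).mul (hζ.continuousAt.pow 2)

lemma tanh_sq_eq_iff {a x x₀ : ℝ} (ha : a ≠ 0) :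
    Real.tanh (a * x) ^ 2 = Real.tanh (a * x₀) ^ 2 ↔ x = x₀ ∨ x = -x₀ := by
  rw [sq_eq_sq_iff_eq_or_eq_neg, ← Real.tanh_neg, Real.tanh_injective.eq_iff,
    Real.tanh_injective.eq_iff, ← mul_neg, mul_right_inj' ha, mul_right_inj' ha]

/-- The energy of a function vanishing at two suitable symmetric points controls its `L²` norm. -/
lemma energy_lower_bound_of_vanishing {a x₀ : ℝ} (ha : 1 / 2 < a) (hx₀ : 0 < x₀)
    (hT : (1 + 3 * a) * Real.tanh (a * x₀) ^ 2 = a) {ζ : ℝ → ℝ} (hζ : FiniteEnergy ζ)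
    (h₁ : ζ x₀ = 0) (h₂ : ζ (-x₀) = 0) :
    3 / 4 * ∫ x, ζ x ^ 2 ≤ energy a ζ := by
  have ha0 : 0 < a := by linarith
  have hne (x : ℝ) : (1 + 3 * a) * Real.tanh (a * x) ^ 2 - a = 0 ↔ x = x₀ ∨ x = -x₀ := by
    have h13 : 1 + 3 * a ≠ 0 := by positivity
    rw [← tanh_sq_eq_iff ha0.ne', ← mul_right_inj' h13 (b := Real.tanh (a * x) ^ 2), hT,
      sub_eq_zero]
  set c : ℝ := 6 * a ^ 2 + 5 / 2 * a + 1 / 4 with hc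
  let P : ℝ → ℝ := fun x => deriv ζ x ^ 2 + 1 / 4 * ζ x ^ 2 -
    c * (1 - Real.tanh (a * x) ^ 2) * ζ x ^ 2
  have hP : Integrable P := (hζ.deriv_sq.add (hζ.sq.const_mul (1 / 4))).sub (by
    simpa only [mul_assoc, sq] using hζ.integrable_sech_sq_mul hζ a c)
  let F : ℝ → ℝ := fun x => riccati a (Real.tanh (a * x)) * ζ x ^ 2
  have hFc : Continuous F := continuous_iff_continuousAt.2 fun x =>
    continuousAt_riccati_mul_sq ha0 (hζ.hasDerivAt x) fun h => by
      rcases (hne x).1 h with rfl | rfl <;> assumption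
  have hpiece {u v : ℝ} (huv : u ≤ v) (hE : ∀ x ∈ Ioo u v, x ≠ x₀ ∧ x ≠ -x₀) :
      F v - F u ≤ ∫ x in u..v, P x := by
    refine intervalIntegral.sub_le_integral_of_hasDeriv_right_of_le huv hFc.continuousOn
      (fun x hx => ((hasDerivAt_riccati fun h => ?_).fun_mul
        (hζ.hasDerivAt_sq x)).hasDerivWithinAt) hP.integrableOn fun x _ => ?_
    · rcases (hne x).1 h with h | h
      exacts [(hE x hx).1 h, (hE x hx).2 h]
    · have := sq_nonneg (deriv ζ x - riccati a (Real.tanh (a * x)) * ζ x)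
      simp only [P, hc]
      nlinarith
  have hF1 : F x₀ = 0 := by simp [F, h₁]
  have hF2 : F (-x₀) = 0 := by simp [F, h₂]
  have hint {u v : ℝ} : IntervalIntegrable P volume u v := hP.intervalIntegrable
  have hineq : ∀ R, x₀ ≤ R → F R - F (-R) ≤ ∫ x in -R..R, P x := by
    intro R hR
    have e1 := hpiece (u := -R) (v := -x₀) (by linarith) fun x hx =>
      ⟨ne_of_lt (by linarith [hx.2]), hx.2.ne⟩
    have e2 := hpiece (u := -x₀) (v := x₀) (by linarith) fun x hx => ⟨hx.2.ne, hx.1.ne'⟩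
    have e3 := hpiece hR fun x hx => ⟨hx.1.ne', ne_of_gt (by linarith [hx.1])⟩
    rw [← intervalIntegral.integral_add_adjacent_intervals (hint (u := -R) (v := -x₀)) hint,
      ← intervalIntegral.integral_add_adjacent_intervals (hint (u := -x₀) (v := x₀)) hint]
    linarith
  have hbound : ∀ᶠ R in atTop, |riccati a (Real.tanh (a * R))| ≤ 1 / 2 + 4 * a * (1 + 3 * a) := by
    have h : (1 + 2 * a) / (2 * (1 + 3 * a)) < 1 := by
      rw [div_lt_one (by positivity)]
      linarith
    filter_upwards [(tendsto_tanh_mul_sq_atTop ha0).eventually_const_lt h] with R hR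
    rw [div_lt_iff₀ (by positivity)] at hR
    exact abs_riccati_le ha0 (tanh_sq_le_one _) (by linarith)
  have hodd (T : ℝ) : |riccati a (-T)| = |riccati a T| := by simp [riccati, abs_mul]
  have hFtop : Tendsto F atTop (𝓝 0) := by
    refine squeeze_zero_norm' (a := fun R => (1 / 2 + 4 * a * (1 + 3 * a)) * ζ R ^ 2) ?_ ?_
    · filter_upwards [hbound] with R hR
      rw [Real.norm_eq_abs, abs_mul, abs_of_nonneg (sq_nonneg (ζ R))]
      gcongr
    · simpa using hζ.tendsto_sq_atTop.const_mul (1 / 2 + 4 * a * (1 + 3 * a))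
  have hFbot : Tendsto (fun R => F (-R)) atTop (𝓝 0) := by
    refine squeeze_zero_norm' (a := fun R => (1 / 2 + 4 * a * (1 + 3 * a)) * ζ (-R) ^ 2) ?_ ?_
    · filter_upwards [hbound] with R hR
      rw [Real.norm_eq_abs, abs_mul, abs_of_nonneg (sq_nonneg (ζ (-R))), mul_neg, Real.tanh_neg,
        hodd]
      gcongr
    · simpa using (hζ.tendsto_sq_atBot.comp tendsto_neg_atTop_atBot).const_mul
        (1 / 2 + 4 * a * (1 + 3 * a))
  have hlim := intervalIntegral_tendsto_integral hP tendsto_neg_atTop_atBot tendsto_id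
  have hPnonneg : 0 ≤ ∫ x, P x := by
    have := le_of_tendsto_of_tendsto (hFtop.sub hFbot) hlim
      ((eventually_ge_atTop x₀).mono hineq)
    simpa using this
  calc 3 / 4 * ∫ x, ζ x ^ 2 ≤ (∫ x, 3 / 4 * ζ x ^ 2) + ∫ x, P x := by
        rw [integral_const_mul]
        linarith
    _ = ∫ x, (3 / 4 * ζ x ^ 2 + P x) := (integral_add (hζ.sq.const_mul _) hP).symm
    _ ≤ ∫ x, (deriv ζ x ^ 2 + ζ x ^ 2 - potential a x * ζ x ^ 2) := by
        refine integral_mono ((hζ.sq.const_mul _).add hP)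
          ((hζ.deriv_sq.add hζ.sq).sub (integrable_potential_mul_sq hζ)) fun x => ?_
        have h1 : 0 ≤ 4 * a ^ 2 - a / 2 - 3 / 4 := by nlinarith
        have h2 : 0 ≤ 1 - Real.tanh (a * x) ^ 2 := by linarith [tanh_sq_le_one (a * x)]
        have := mul_nonneg (mul_nonneg h1 h2) (sq_nonneg (ζ x))
        simp only [P, hc, potential]
        nlinarith

/-! ### Coercivity modulo two eigenfunctions -/

lemma integral_eq_zero_of_odd {f : ℝ → ℝ} (hf : ∀ x, f (-x) = -f x) : ∫ x, f x = 0 := by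
  have h := integral_neg_eq_self f volume
  simp only [hf, integral_neg] at h
  linarith

lemma FiniteEnergy.integral_sq_pos {f : ℝ → ℝ} (hf : FiniteEnergy f) {x : ℝ} (hx : f x ≠ 0) :
    0 < ∫ x, f x ^ 2 :=
  integral_pos_of_integrable_nonneg_nonzero (hf.continuous.pow 2) hf.sq
    (fun x => sq_nonneg (f x)) (pow_ne_zero 2 hx)

lemma integral_add_add_sq {f Y Z : ℝ → ℝ} (hf : FiniteEnergy f) (hY : FiniteEnergy Y)
    (hZ : FiniteEnergy Z) (hYZ : ∫ x, Y x * Z x = 0) (α β : ℝ) :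
    ∫ x, (f x + (α * Y x + β * Z x)) ^ 2 = (∫ x, f x ^ 2) + α ^ 2 * (∫ x, Y x ^ 2) +
      β ^ 2 * (∫ x, Z x ^ 2) + 2 * α * (∫ x, f x * Y x) + 2 * β * ∫ x, f x * Z x := by
  have e : ∀ x, (f x + (α * Y x + β * Z x)) ^ 2 = f x ^ 2 + α ^ 2 * Y x ^ 2 + β ^ 2 * Z x ^ 2 +
      2 * α * (f x * Y x) + 2 * β * (f x * Z x) + 2 * α * β * (Y x * Z x) := fun x => by ring
  have i1 : Integrable fun x => f x ^ 2 + α ^ 2 * Y x ^ 2 := hf.sq.add (hY.sq.const_mul _)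
  have i2 : Integrable fun x => f x ^ 2 + α ^ 2 * Y x ^ 2 + β ^ 2 * Z x ^ 2 :=
    i1.add (hZ.sq.const_mul _)
  have i3 : Integrable fun x => f x ^ 2 + α ^ 2 * Y x ^ 2 + β ^ 2 * Z x ^ 2 +
      2 * α * (f x * Y x) := i2.add ((hf.integrable_mul hY).const_mul _)
  have i4 : Integrable fun x => f x ^ 2 + α ^ 2 * Y x ^ 2 + β ^ 2 * Z x ^ 2 +
      2 * α * (f x * Y x) + 2 * β * (f x * Z x) := i3.add ((hf.integrable_mul hZ).const_mul _)
  simp only [e]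
  rw [integral_add i4 ((hY.integrable_mul hZ).const_mul _),
    integral_add i3 ((hf.integrable_mul hZ).const_mul _),
    integral_add i2 ((hf.integrable_mul hY).const_mul _),
    integral_add i1 (hZ.sq.const_mul _), integral_add hf.sq (hY.sq.const_mul _)]
  simp only [integral_const_mul, hYZ]
  ring

lemma exists_tanh_sq_eq {a : ℝ} (ha : 0 < a) :
    ∃ x₀, 0 < x₀ ∧ (1 + 3 * a) * Real.tanh (a * x₀) ^ 2 = a := by
  have h0 : 0 < a / (1 + 3 * a) := by positivity
  have h1 : a / (1 + 3 * a) < 1 := by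
    rw [div_lt_one (by positivity)]
    linarith
  have hs : √(a / (1 + 3 * a)) ∈ Ioo (0 : ℝ) 1 :=
    ⟨Real.sqrt_pos.2 h0, (Real.sqrt_lt' one_pos).2 (by simpa using h1)⟩
  refine ⟨Real.artanh √(a / (1 + 3 * a)) / a, div_pos (Real.artanh_pos hs) ha, ?_⟩
  rw [mul_div_cancel₀ _ ha.ne', Real.tanh_artanh ⟨by linarith [hs.1], hs.2⟩, Real.sq_sqrt h0.le]
  field_simp

/-- The energy controls the `L²` norm up to the components along an even negative eigenfunction
`Y` and an odd element `Z` of the kernel. -/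
lemma integral_sq_le_energy_add {a ν z : ℝ} (ha : 1 / 2 < a) {f Y Z : ℝ → ℝ}
    (hf : FiniteEnergy f) (hY : FiniteEnergy Y) (hZ : FiniteEnergy Z)
    (hY' : ∀ x, HasDerivAt (deriv Y) (Y x - potential a x * Y x + ν ^ 2 * Y x) x)
    (hZ' : ∀ x, HasDerivAt (deriv Z) (Z x - potential a x * Z x) x)
    (hYeven : ∀ x, Y (-x) = Y x) (hZodd : ∀ x, Z (-x) = -Z x)
    (hYpos : ∀ x, 0 < Y x) (hZne : ∀ x, 0 < x → Z x ≠ 0) (hY1 : ∫ x, Y x ^ 2 = 1)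
    (hz : z = ∫ x, Z x ^ 2) :
    3 / 4 * ∫ x, f x ^ 2 ≤ energy a f + (3 / 4 + ν ^ 2) * (∫ x, f x * Y x) ^ 2 +
      3 / 4 / z * (∫ x, f x * Z x) ^ 2 := by
  obtain ⟨x₀, hx₀, hT⟩ := exists_tanh_sq_eq (by linarith : 0 < a)
  have hzpos : 0 < z := hz ▸ hZ.integral_sq_pos (hZne x₀ hx₀)
  have hYZ : ∫ x, Y x * Z x = 0 := integral_eq_zero_of_odd fun x => by simp [hYeven, hZodd]
  obtain ⟨α, hα⟩ : ∃ α, α = -(f x₀ + f (-x₀)) / (2 * Y x₀) := ⟨_, rfl⟩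
  obtain ⟨β, hβ⟩ : ∃ β, β = -(f x₀ - f (-x₀)) / (2 * Z x₀) := ⟨_, rfl⟩
  have hYx := (hYpos x₀).ne'
  have hZx := hZne x₀ hx₀
  have hw : FiniteEnergy fun x => α * Y x + β * Z x := (hY.const_mul α).add (hZ.const_mul β)
  have hwd : deriv (fun x => α * Y x + β * Z x) = fun x => α * deriv Y x + β * deriv Z x :=
    funext fun x => (((hY.hasDerivAt x).const_mul α).fun_add ((hZ.hasDerivAt x).const_mul β)).deriv
  have hw' (x : ℝ) : HasDerivAt (deriv fun x => α * Y x + β * Z x)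
      ((α * Y x + β * Z x) - potential a x * (α * Y x + β * Z x) + ν ^ 2 * α * Y x) x := by
    rw [hwd]
    refine (((hY' x).const_mul α).fun_add ((hZ' x).const_mul β)).congr_deriv ?_
    ring
  have hadd := energy_add hf hw (hY.const_mul (ν ^ 2 * α)) hw'
  have hpair : ∫ x, (2 * f x + (α * Y x + β * Z x)) * (ν ^ 2 * α * Y x) =
      2 * (ν ^ 2 * α) * (∫ x, f x * Y x) + ν ^ 2 * α ^ 2 := by
    have e : ∀ x, (2 * f x + (α * Y x + β * Z x)) * (ν ^ 2 * α * Y x) =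
      2 * (ν ^ 2 * α) * (f x * Y x) + ν ^ 2 * α ^ 2 * Y x ^ 2 +
        ν ^ 2 * α * β * (Y x * Z x) := fun x => by ring
    have i1 : Integrable fun x => 2 * (ν ^ 2 * α) * (f x * Y x) + ν ^ 2 * α ^ 2 * Y x ^ 2 :=
      ((hf.integrable_mul hY).const_mul _).add (hY.sq.const_mul _)
    simp only [e]
    rw [integral_add i1 ((hY.integrable_mul hZ).const_mul _),
      integral_add ((hf.integrable_mul hY).const_mul _) (hY.sq.const_mul _)]
    simp only [integral_const_mul, hYZ, hY1]
    ring
  have hmain := energy_lower_bound_of_vanishing ha hx₀ hT (hf.add hw)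
    (by rw [hα, hβ]; field_simp; ring)
    (by rw [hYeven, hZodd, hα, hβ]; field_simp; ring)
  rw [hadd, hpair, integral_add_add_sq hf hY hZ hYZ, hY1, ← hz] at hmain
  generalize (∫ x, f x * Y x) = y at *
  generalize (∫ x, f x * Z x) = w at *
  have h1 := mul_nonneg (add_nonneg (by norm_num : (0 : ℝ) ≤ 3 / 4) (sq_nonneg ν))
    (sq_nonneg (α + y))
  have h2 : 0 ≤ 3 / 4 * (β ^ 2 * z + 2 * β * w) + 3 / 4 / z * w ^ 2 := by
    have : 3 / 4 * (β ^ 2 * z + 2 * β * w) + 3 / 4 / z * w ^ 2 = 3 / 4 / z * (β * z + w) ^ 2 := by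
      field_simp
      ring
    rw [this]
    positivity
  linarith

lemma exists_coercivity_of_eigenfunctions {a ν : ℝ} (ha : 1 / 2 < a) {Y Z : ℝ → ℝ}
    (hY : FiniteEnergy Y) (hZ : FiniteEnergy Z)
    (hY' : ∀ x, HasDerivAt (deriv Y) (Y x - potential a x * Y x + ν ^ 2 * Y x) x)
    (hZ' : ∀ x, HasDerivAt (deriv Z) (Z x - potential a x * Z x) x)
    (hYeven : ∀ x, Y (-x) = Y x) (hZodd : ∀ x, Z (-x) = -Z x)
    (hYpos : ∀ x, 0 < Y x) (hZne : ∀ x, 0 < x → Z x ≠ 0) (hY1 : ∫ x, Y x ^ 2 = 1) :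
    ∃ c > 0, ∀ f, FiniteEnergy f → c * (∫ x, (deriv f x ^ 2 + f x ^ 2)) -
      c⁻¹ * ((∫ x, f x * Y x) ^ 2 + (∫ x, f x * Z x) ^ 2) ≤ energy a f := by
  have ha0 : 0 < a := by linarith
  have hzpos : 0 < ∫ x, Z x ^ 2 := hZ.integral_sq_pos (hZne 1 one_pos)
  obtain ⟨z, hz⟩ : ∃ z, z = ∫ x, Z x ^ 2 := ⟨_, rfl⟩
  rw [← hz] at hzpos
  obtain ⟨M, hM⟩ : ∃ M, M = (1 + a) * (1 + 2 * a) := ⟨_, rfl⟩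
  have hM0 : 0 < M := hM ▸ by positivity
  obtain ⟨K, hK⟩ : ∃ K, K = 3 / 4 + ν ^ 2 + 3 / 4 / z := ⟨_, rfl⟩
  have hz' : 0 < 3 / 4 / z := by positivity
  have hK0 : 0 < K := by nlinarith [sq_nonneg ν]
  obtain ⟨θ, hθ⟩ : ∃ θ, θ = 3 / 4 / (3 / 4 + M) := ⟨_, rfl⟩
  have hθ0 : 0 < θ := hθ ▸ by positivity
  have hθM : θ * (3 / 4 + M) = 3 / 4 := by
    rw [hθ]
    field_simp
  have hθ1 : θ ≤ 1 := by nlinarith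
  refine ⟨min θ K⁻¹, lt_min hθ0 (inv_pos.2 hK0), fun f hf => ?_⟩
  have h1 := integral_sq_le_energy_add ha hf hY hZ hY' hZ' hYeven hZodd hYpos hZne hY1 hz
  have h2 := le_energy ha0.le hf
  rw [← hM] at h2
  have hH : 0 ≤ ∫ x, (deriv f x ^ 2 + f x ^ 2) := integral_nonneg fun x => by positivity
  have hcK : K ≤ (min θ K⁻¹)⁻¹ := by
    rw [le_inv_comm₀ hK0 (lt_min hθ0 (inv_pos.2 hK0))]
    exact min_le_right _ _
  have hcθ := mul_le_mul_of_nonneg_right (min_le_left θ K⁻¹) hH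
  have hyw := add_nonneg (sq_nonneg (∫ x, f x * Y x)) (sq_nonneg (∫ x, f x * Z x))
  have hcS := mul_le_mul_of_nonneg_right hcK hyw
  have hKS : (3 / 4 + ν ^ 2) * (∫ x, f x * Y x) ^ 2 + 3 / 4 / z * (∫ x, f x * Z x) ^ 2 ≤
      K * ((∫ x, f x * Y x) ^ 2 + (∫ x, f x * Z x) ^ 2) := by
    rw [hK]
    nlinarith [mul_nonneg hz'.le (sq_nonneg (∫ x, f x * Y x)),
      mul_nonneg (add_nonneg (by norm_num : (0 : ℝ) ≤ 3 / 4) (sq_nonneg ν))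
        (sq_nonneg (∫ x, f x * Z x))]
  have hKS0 := mul_nonneg (mul_nonneg hθ0.le hK0.le) hyw
  have h3 := mul_le_mul_of_nonneg_left h2 hθ0.le
  have h4 := mul_le_mul_of_nonneg_left (h1.trans (by linarith : _ ≤ energy a f +
    K * ((∫ x, f x * Y x) ^ 2 + (∫ x, f x * Z x) ^ 2))) (sub_nonneg.2 hθ1)
  have h5 : (1 - θ) * (3 / 4 * ∫ x, f x ^ 2) = θ * (M * ∫ x, f x ^ 2) := by
    linear_combination (-∫ x, f x ^ 2) * hθM
  linarith

/-! ### The explicit eigenfunctions -/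

lemma abs_tanh_le_one (x : ℝ) : |Real.tanh x| ≤ 1 :=
  (sq_le_one_iff_abs_le_one _).1 (tanh_sq_le_one x)

section Eigenfunctions

variable {a : ℝ}

lemma hasDerivAt_cosh_rpow_mul (ha : a ≠ 0) (x : ℝ) :
    HasDerivAt (fun x => Real.cosh (a * x) ^ (-((1 + a) / a)))
      (-(1 + a) * (Real.tanh (a * x) * Real.cosh (a * x) ^ (-((1 + a) / a)))) x := by
  refine (hasDerivAt_cosh_mul_rpow a ((1 + a) / a) x).congr_deriv ?_
  rw [div_mul_cancel₀ _ ha]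

lemma contDiff_cosh_mul_rpow (a k : ℝ) {n : WithTop ℕ∞} :
    ContDiff ℝ n fun x => Real.cosh (a * x) ^ (-k) :=
  (Real.contDiff_cosh.comp (contDiff_const.mul contDiff_id)).rpow_const_of_ne
    fun x => (Real.cosh_pos (a * x)).ne'

lemma hasDerivAt_deriv_ground (ha : a ≠ 0) (x : ℝ) :
    HasDerivAt (deriv fun x => Real.cosh (a * x) ^ (-((1 + a) / a)))
      (Real.cosh (a * x) ^ (-((1 + a) / a)) -
        potential a x * Real.cosh (a * x) ^ (-((1 + a) / a)) +
        ((1 + a) ^ 2 - 1) * Real.cosh (a * x) ^ (-((1 + a) / a))) x := by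
  rw [funext fun x => (hasDerivAt_cosh_rpow_mul ha x).deriv]
  refine (((hasDerivAt_tanh_mul a x).fun_mul (hasDerivAt_cosh_rpow_mul ha x)).const_mul
    (-(1 + a))).congr_deriv ?_
  rw [potential]
  ring

lemma finiteEnergy_ground (ha : 0 < a) :
    FiniteEnergy fun x => Real.cosh (a * x) ^ (-((1 + a) / a)) := by
  have hk : 1 ≤ (1 + a) / a * a := by
    rw [div_mul_cancel₀ _ ha.ne']
    linarith
  refine ⟨contDiff_cosh_mul_rpow _ _, integrable_sq_cosh_mul_rpow ha hk, ?_⟩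
  refine integrable_sq_of_abs_le_cosh_mul_rpow (C := 1 + a) ha hk
    ((contDiff_cosh_mul_rpow _ _).continuous_deriv le_rfl) fun x => ?_
  rw [(hasDerivAt_cosh_rpow_mul ha.ne' x).deriv, abs_mul, abs_mul, abs_neg,
    abs_of_pos (by linarith : 0 < 1 + a),
    abs_of_pos (Real.rpow_pos_of_pos (Real.cosh_pos (a * x)) _)]
  gcongr
  exact mul_le_of_le_one_left (by positivity) (abs_tanh_le_one _)

lemma hasDerivAt_kernel (ha : a ≠ 0) (x : ℝ) :
    HasDerivAt (fun x => Real.tanh (a * x) * Real.cosh (a * x) ^ (-(1 / a)))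
      ((a - (1 + a) * Real.tanh (a * x) ^ 2) * Real.cosh (a * x) ^ (-(1 / a))) x := by
  refine ((hasDerivAt_tanh_mul a x).fun_mul (hasDerivAt_cosh_mul_rpow a (1 / a) x)).congr_deriv ?_
  rw [div_mul_cancel₀ _ ha]
  ring

lemma hasDerivAt_deriv_kernel (ha : a ≠ 0) (x : ℝ) :
    HasDerivAt (deriv fun x => Real.tanh (a * x) * Real.cosh (a * x) ^ (-(1 / a)))
      (Real.tanh (a * x) * Real.cosh (a * x) ^ (-(1 / a)) -
        potential a x * (Real.tanh (a * x) * Real.cosh (a * x) ^ (-(1 / a)))) x := by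
  rw [funext fun x => (hasDerivAt_kernel ha x).deriv]
  refine (((((hasDerivAt_tanh_mul a x).fun_pow 2).const_mul (1 + a)).const_sub a).fun_mul
    (hasDerivAt_cosh_mul_rpow a (1 / a) x)).congr_deriv ?_
  rw [potential, div_mul_cancel₀ _ ha]
  push_cast
  ring

lemma finiteEnergy_kernel (ha : 0 < a) :
    FiniteEnergy fun x => Real.tanh (a * x) * Real.cosh (a * x) ^ (-(1 / a)) := by
  have hk : 1 ≤ 1 / a * a := by rw [div_mul_cancel₀ _ ha.ne']
  have hc : Continuous (deriv fun x => Real.tanh (a * x) * Real.cosh (a * x) ^ (-(1 / a))) :=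
    continuous_iff_continuousAt.2 fun x => (hasDerivAt_deriv_kernel ha.ne' x).continuousAt
  refine ⟨contDiff_one_iff_deriv.2
    ⟨fun x => (hasDerivAt_kernel ha.ne' x).differentiableAt, hc⟩, ?_, ?_⟩
  · refine integrable_sq_of_abs_le_cosh_mul_rpow (C := 1) ha hk
      ((continuous_tanh_mul a).mul (continuous_cosh_mul_rpow a _)) fun x => ?_
    rw [abs_mul, abs_of_pos (Real.rpow_pos_of_pos (Real.cosh_pos (a * x)) _)]
    gcongr
    exact abs_tanh_le_one _
  · refine integrable_sq_of_abs_le_cosh_mul_rpow (C := 1 + a) ha hk hc fun x => ?_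
    rw [(hasDerivAt_kernel ha.ne' x).deriv, abs_mul,
      abs_of_pos (Real.rpow_pos_of_pos (Real.cosh_pos (a * x)) _)]
    gcongr
    have := tanh_sq_le_one (a * x)
    rw [abs_le]
    constructor <;> nlinarith [sq_nonneg (Real.tanh (a * x))]

end Eigenfunctions

lemma Q_eq {p : ℝ} (hp : 1 < p) (x : ℝ) :
    Q p x = ((p + 1) / 2) ^ (1 / (p - 1)) *
      Real.cosh ((p - 1) / 2 * x) ^ (-(1 / ((p - 1) / 2))) := by
  have hc := Real.cosh_pos ((p - 1) / 2 * x)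
  have hp1 : p - 1 ≠ 0 := by linarith
  rw [Q, ← div_div, Real.div_rpow (by linarith) (by positivity), div_eq_mul_inv,
    ← Real.rpow_natCast, ← Real.rpow_mul hc.le, ← Real.rpow_neg hc.le]
  congr 2
  push_cast
  field_simp

lemma mul_Q_rpow {p : ℝ} (hp : 1 < p) (x : ℝ) :
    p * Q p x ^ (p - 1) = potential ((p - 1) / 2) x := by
  have hc := Real.cosh_pos ((p - 1) / 2 * x)
  have hp1 : p - 1 ≠ 0 := by linarith
  rw [Q, ← Real.rpow_mul (by positivity), one_div_mul_cancel hp1, Real.rpow_one, potential,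
    one_sub_tanh_sq]
  field_simp
  ring

lemma deriv_Q {p : ℝ} (hp : 1 < p) :
    deriv (Q p) = fun x => -((p + 1) / 2) ^ (1 / (p - 1)) *
      (Real.tanh ((p - 1) / 2 * x) * Real.cosh ((p - 1) / 2 * x) ^ (-(1 / ((p - 1) / 2)))) := by
  have hp1 : (p - 1) / 2 ≠ 0 := by linarith
  ext x
  rw [funext (Q_eq hp), ((hasDerivAt_cosh_mul_rpow ((p - 1) / 2) (1 / ((p - 1) / 2)) x).const_mul
    (((p + 1) / 2) ^ (1 / (p - 1)))).deriv, div_mul_cancel₀ _ hp1]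
  ring

theorem linearized_operator_coercivity (p : ℝ) (hp : 2 < p) :
    ∃ ν₀ : ℝ, 0 < ν₀ ∧ ∃ Y : ℝ → ℝ, ∃ C > 0,
      ContDiff ℝ (⊤ : ℕ∞) Y ∧
      (∫ x : ℝ, Y x ^ 2) = 1 ∧
      (∀ x : ℝ, -(deriv (deriv Y) x) + Y x - p * Q p x ^ (p - 1) * Y x = -(ν₀ ^ 2) * Y x) ∧
      (∀ x : ℝ, |Y x| ≤ C * Real.exp (-Real.sqrt (1 + ν₀ ^ 2) * |x|)) ∧
      ∃ c > 0, ∀ ε : ℝ → ℝ, ContDiff ℝ 1 ε →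
        Integrable (fun x => ε x ^ 2) →
        Integrable (fun x => deriv ε x ^ 2) →
        (∫ x : ℝ, (deriv ε x ^ 2 + ε x ^ 2 - p * Q p x ^ (p - 1) * ε x ^ 2))
          ≥ c * (∫ x : ℝ, (deriv ε x ^ 2 + ε x ^ 2)) -
            c⁻¹ * ((∫ x : ℝ, ε x * Y x) ^ 2 + (∫ x : ℝ, ε x * deriv (Q p) x) ^ 2) := by
  have hp1 : 1 < p := by linarith
  have hZ_def := deriv_Q hp1
  simp only [mul_Q_rpow hp1]
  obtain ⟨a, ha_def⟩ : ∃ a, a = (p - 1) / 2 := ⟨_, rfl⟩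
  rw [← ha_def] at hZ_def ⊢
  have ha : 1 / 2 < a := by linarith
  have ha0 : 0 < a := by linarith
  have hν : 0 < (1 + a) ^ 2 - 1 := by nlinarith
  obtain ⟨κ, hκ⟩ : ∃ κ, κ = -((p + 1) / 2) ^ (1 / (p - 1)) := ⟨_, rfl⟩
  have hκ0 : κ ≠ 0 := by
    rw [hκ]
    exact neg_ne_zero.2 (Real.rpow_pos_of_pos (by linarith) _).ne'
  rw [← hκ] at hZ_def
  have hG := finiteEnergy_ground ha0
  have hGpos (x : ℝ) : 0 < Real.cosh (a * x) ^ (-((1 + a) / a)) :=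
    Real.rpow_pos_of_pos (Real.cosh_pos _) _
  have hI := hG.integral_sq_pos (hGpos 0).ne'
  obtain ⟨N, hN⟩ : ∃ N, N = (√(∫ x, (Real.cosh (a * x) ^ (-((1 + a) / a))) ^ 2))⁻¹ := ⟨_, rfl⟩
  have hN0 : 0 < N := hN ▸ inv_pos.2 (Real.sqrt_pos.2 hI)
  have hY := hG.const_mul N
  have hY1 : ∫ x, (N * Real.cosh (a * x) ^ (-((1 + a) / a))) ^ 2 = 1 := by
    simp only [mul_pow]
    rw [integral_const_mul, hN, inv_pow, Real.sq_sqrt hI.le, inv_mul_cancel₀ hI.ne']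
  have hY' (x : ℝ) : HasDerivAt (deriv fun x => N * Real.cosh (a * x) ^ (-((1 + a) / a)))
      (N * Real.cosh (a * x) ^ (-((1 + a) / a)) -
        potential a x * (N * Real.cosh (a * x) ^ (-((1 + a) / a))) +
        √((1 + a) ^ 2 - 1) ^ 2 * (N * Real.cosh (a * x) ^ (-((1 + a) / a)))) x := by
    rw [funext fun x => ((hG.hasDerivAt x).const_mul N).deriv, Real.sq_sqrt hν.le]
    refine ((hasDerivAt_deriv_ground ha0.ne' x).const_mul N).congr_deriv ?_
    ring
  have hK := finiteEnergy_kernel ha0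
  have hZ : FiniteEnergy (deriv (Q p)) := hZ_def ▸ hK.const_mul κ
  have hZ' (x : ℝ) : HasDerivAt (deriv (deriv (Q p)))
      (deriv (Q p) x - potential a x * deriv (Q p) x) x := by
    rw [hZ_def, funext fun x => ((hK.hasDerivAt x).const_mul κ).deriv]
    refine ((hasDerivAt_deriv_kernel ha0.ne' x).const_mul κ).congr_deriv ?_
    ring
  obtain ⟨c, hc, hcoer⟩ := exists_coercivity_of_eigenfunctions ha hY hZ hY' hZ'
    (fun x => by simp) (fun x => by simp [hZ_def]) (fun x => mul_pos hN0 (hGpos x))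
    (fun x hx => by
      have : 0 < Real.sinh (a * x) := Real.sinh_pos_iff.2 (mul_pos ha0 hx)
      have hcosh := Real.cosh_pos (a * x)
      simp only [hZ_def, Real.tanh_eq_sinh_div_cosh]
      positivity) hY1
  refine ⟨√((1 + a) ^ 2 - 1), Real.sqrt_pos.2 hν, _, N * 2 ^ ((1 + a) / a), by positivity,
    contDiff_const.mul (contDiff_cosh_mul_rpow _ _), hY1, fun x => ?_, fun x => ?_, c, hc,
    fun f hf hf2 hf' => hcoer f ⟨hf, hf2, hf'⟩⟩
  · rw [(hY' x).deriv]
    ring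
  · have h := cosh_mul_rpow_le (k := (1 + a) / a) ha0.le (by positivity) x
    rw [div_mul_cancel₀ _ ha0.ne'] at h
    rw [Real.sq_sqrt hν.le, add_sub_cancel, Real.sqrt_sq (by linarith),
      abs_of_pos (mul_pos hN0 (hGpos x)), mul_assoc]
    gcongr
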